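/- Instability of best approximations: assume additionally closure(S) ≠ Y (whence Θ ∈ (0,1) and dim Y ≥ 2). For C > 0, say that y_d ∈ Y has property Q_C if there exist sequences (y^l)_{l ∈ ℕ} and (ỹ^l)_{l ∈ ℕ} in Y with y^l → y_d and ỹ^l → y_d such that for every l the sets P(y^l) and P(ỹ^l) are singletons {z^l} and {z̃^l} with ‖z^l − z̃^l‖ ≥ C. Then for every C > 0 the set of all y_d ∈ Y with property Q_C is uncountable, and there exists a y_d ∈ Y with ‖y_d‖ = C·((dim Y − 1)/(2·(dim Y)·(Θ − Θ²)))^{1/2} such that s·y_d has property Q_C for every s ≥ 1. -/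

import Mathlib

open Filter Metric
open scoped InnerProductSpace

noncomputable section

/-- The optimal value of the squared loss `inf_{α ∈ D} ‖F α - y‖²`. -/
def lossInf {Y : Type} [NormedAddCommGroup Y] {m : ℕ}
    (D : Set (Fin m → ℝ)) (F : (Fin m → ℝ) → Y) (y : Y) : ℝ :=
  sInf ((fun α => ‖F α - y‖ ^ 2) '' D)

/-- The worst-case error bound `Θ = sup_{‖y‖ = 1} inf_{α ∈ D} ‖F α - y‖²`. -/
def Theta {Y : Type} [NormedAddCommGroup Y] {m : ℕ}
    (D : Set (Fin m → ℝ)) (F : (Fin m → ℝ) → Y) : ℝ :=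
  sSup ((fun y => lossInf D F y) '' {y : Y | ‖y‖ = 1})

/-- The set of best approximations of `y` in `closure (F '' D)`. -/
def bestApprox {Y : Type} [NormedAddCommGroup Y] {m : ℕ}
    (D : Set (Fin m → ℝ)) (F : (Fin m → ℝ) → Y) (y : Y) : Set Y :=
  {z | z ∈ closure (F '' D) ∧ ‖z - y‖ = Metric.infDist y (closure (F '' D))}

/-- Property `Q_C`: there are two sequences of label vectors converging to `yd` whose
(unique) best approximations stay at distance at least `C` from each other. -/
def propQ {Y : Type} [NormedAddCommGroup Y] {m : ℕ}
    (D : Set (Fin m → ℝ)) (F : (Fin m → ℝ) → Y) (C : ℝ) (yd : Y) : Prop :=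
  ∃ ys yt : ℕ → Y,
    Filter.Tendsto ys Filter.atTop (nhds yd) ∧
    Filter.Tendsto yt Filter.atTop (nhds yd) ∧
    ∀ l : ℕ, ∃ z z' : Y,
      bestApprox D F (ys l) = {z} ∧ bestApprox D F (yt l) = {z'} ∧ C ≤ ‖z - z'‖

section NearestPoint

variable {Y : Type} [NormedAddCommGroup Y]

/-- `z` is a point of `K` nearest to `y`. -/
def IsNearest (K : Set Y) (y z : Y) : Prop :=
  z ∈ K ∧ ∀ w ∈ K, ‖z - y‖ ≤ ‖w - y‖

theorem IsNearest.norm_eq_infDist {K : Set Y} {y z : Y} (h : IsNearest K y z) :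
    ‖z - y‖ = infDist y K := by
  apply le_antisymm
  · refine (le_infDist ⟨z, h.1⟩).2 fun w hw => ?_
    rw [dist_comm, dist_eq_norm]
    exact h.2 w hw
  · rw [← dist_eq_norm, dist_comm]
    exact infDist_le_dist_of_mem h.1

theorem isNearest_of_norm_eq_infDist {K : Set Y} {y z : Y} (hz : z ∈ K)
    (h : ‖z - y‖ = infDist y K) : IsNearest K y z := by
  refine ⟨hz, fun w hw => ?_⟩
  rw [h, ← dist_eq_norm, dist_comm]
  exact infDist_le_dist_of_mem hw

theorem bestApprox_eq_setOf_isNearest {m : ℕ} (D : Set (Fin m → ℝ)) (F : (Fin m → ℝ) → Y)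
    (y : Y) : bestApprox D F y = {z | IsNearest (closure (F '' D)) y z} := by
  ext z
  exact ⟨fun h => isNearest_of_norm_eq_infDist h.1 h.2, fun h => ⟨h.1, h.norm_eq_infDist⟩⟩

theorem lossInf_eq_infDist_sq {m : ℕ} {D : Set (Fin m → ℝ)} (hD : D.Nonempty)
    (F : (Fin m → ℝ) → Y) (y : Y) : lossInf D F y = infDist y (closure (F '' D)) ^ 2 := by
  rw [infDist_closure]
  have hbdd : BddBelow ((fun α => ‖F α - y‖ ^ 2) '' D) := by
    refine ⟨0, ?_⟩
    rintro _ ⟨α, -, rfl⟩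
    positivity
  apply le_antisymm
  · by_contra! h
    obtain ⟨_, ⟨α, hα, rfl⟩, hlt⟩ :=
      (infDist_lt_iff (hD.image F)).1 (Real.lt_sqrt_of_sq_lt h)
    rw [dist_comm, dist_eq_norm] at hlt
    have h1 : ‖F α - y‖ ^ 2 < lossInf D F y := (Real.lt_sqrt (norm_nonneg _)).1 hlt
    exact absurd (csInf_le hbdd ⟨α, hα, rfl⟩) (not_le.2 h1)
  · refine le_csInf (hD.image _) ?_
    rintro _ ⟨α, hα, rfl⟩
    have := infDist_le_dist_of_mem (x := y) (Set.mem_image_of_mem F hα)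
    rw [dist_comm, dist_eq_norm] at this
    exact pow_le_pow_left₀ infDist_nonneg this 2

variable [InnerProductSpace ℝ Y]

theorem IsNearest.smul {K : Set Y} (hK : ∀ y ∈ K, ∀ s : ℝ, 0 ≤ s → s • y ∈ K) {y z : Y}
    (h : IsNearest K y z) {s : ℝ} (hs : 0 < s) : IsNearest K (s • y) (s • z) := by
  refine ⟨hK z h.1 s hs.le, fun w hw => ?_⟩
  have h1 := h.2 _ (hK w hw s⁻¹ (inv_nonneg.2 hs.le))
  have h2 : w - s • y = s • (s⁻¹ • w - y) := by
    rw [smul_sub, smul_inv_smul₀ hs.ne']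
  rw [h2, ← smul_sub, norm_smul, norm_smul]
  gcongr

/-- A nearest point in a cone is orthogonal to the residual. -/
theorem IsNearest.inner_eq_norm_sq {K : Set Y} (hK : ∀ y ∈ K, ∀ s : ℝ, 0 ≤ s → s • y ∈ K)
    {y z : Y} (h : IsNearest K y z) : ⟪z, y⟫_ℝ = ‖z‖ ^ 2 := by
  have key : ∀ s : ℝ, 0 ≤ s →
      ‖z‖ ^ 2 - 2 * ⟪z, y⟫_ℝ ≤ s ^ 2 * ‖z‖ ^ 2 - 2 * s * ⟪z, y⟫_ℝ := by
    intro s hs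
    have h1 := pow_le_pow_left₀ (norm_nonneg _) (h.2 _ (hK z h.1 s hs)) 2
    rw [norm_sub_sq_real, norm_sub_sq_real, norm_smul, inner_smul_left, mul_pow,
      Real.norm_eq_abs, sq_abs] at h1
    simp only [conj_trivial] at h1
    linarith
  rcases eq_or_ne z 0 with rfl | hz
  · simp
  have ha : 0 < ‖z‖ ^ 2 := by positivity
  generalize ‖z‖ ^ 2 = a at *
  generalize ⟪z, y⟫_ℝ = b at *
  have hb : 0 ≤ b := by nlinarith [key 0 le_rfl]
  have h1 := key (b / a) (by positivity)
  have h2 : (b / a) ^ 2 * a - 2 * (b / a) * b = -(b ^ 2 / a) := by field_simp; ring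
  rw [h2, le_neg, div_le_iff₀ ha] at h1
  nlinarith [sq_nonneg (a - b)]

theorem IsNearest.norm_sq_of_norm_eq_one {K : Set Y}
    (hcone : ∀ y ∈ K, ∀ s : ℝ, 0 ≤ s → s • y ∈ K) {y z : Y} (hy : ‖y‖ = 1)
    (h : IsNearest K y z) : ‖z‖ ^ 2 = 1 - infDist y K ^ 2 := by
  have h1 := h.inner_eq_norm_sq hcone
  rw [← h.norm_eq_infDist, norm_sub_sq_real, h1, hy]
  ring

/-- Along the segment from `y` to a nearest point `z`, the point `z` is the unique nearest one. -/
theorem IsNearest.setOf_segment_eq_singleton {K : Set Y} {y z : Y} (h : IsNearest K y z) {t : ℝ}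
    (ht : 0 < t) (ht1 : t ≤ 1) : {w | IsNearest K (y + t • (z - y)) w} = {z} := by
  have hz : z - (y + t • (z - y)) = (1 - t) • (z - y) := by module
  have hzn : ‖z - (y + t • (z - y))‖ = (1 - t) * ‖z - y‖ := by
    rw [hz, norm_smul, Real.norm_of_nonneg (by linarith)]
  ext w
  simp only [Set.mem_ofPred_eq, Set.mem_singleton_iff]
  constructor
  · intro hw
    have h1 := hw.2 z h.1
    have h2 := h.2 w hw.1
    rw [hzn] at h1
    have hu : w - y = (w - (y + t • (z - y))) + t • (z - y) := by module
    rw [hu] at h2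
    suffices w - (y + t • (z - y)) = z - (y + t • (z - y)) from sub_left_injective this
    rw [hz]
    generalize w - (y + t • (z - y)) = u at *
    generalize z - y = a at *
    have h1' := pow_le_pow_left₀ (norm_nonneg _) h1 2
    have h2' := pow_le_pow_left₀ (norm_nonneg _) h2 2
    rw [norm_add_sq_real, inner_smul_right, norm_smul, Real.norm_of_nonneg ht.le] at h2'
    have h3 : (1 - t) * ‖a‖ ^ 2 ≤ ⟪u, a⟫_ℝ := by
      refine le_of_mul_le_mul_left ?_ ht
      nlinarith
    rw [← sub_eq_zero, ← norm_eq_zero, ← sq_eq_zero_iff]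
    refine le_antisymm ?_ (by positivity)
    rw [norm_sub_sq_real, inner_smul_right, norm_smul, Real.norm_of_nonneg (by linarith)]
    nlinarith [mul_le_mul_of_nonneg_left h3 (sub_nonneg.2 ht1)]
  · rintro rfl
    refine ⟨h.1, fun v hv => ?_⟩
    rw [hzn]
    have h1 := h.2 v hv
    have h2 := norm_add_le (v - (y + t • (w - y))) (t • (w - y))
    rw [norm_smul, Real.norm_of_nonneg ht.le,
      show v - (y + t • (w - y)) + t • (w - y) = v - y by module] at h2
    linarith

theorem IsNearest.propQ {m : ℕ} {D : Set (Fin m → ℝ)} {F : (Fin m → ℝ) → Y} {y z z' : Y}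
    (h : IsNearest (closure (F '' D)) y z) (h' : IsNearest (closure (F '' D)) y z') {C : ℝ}
    (hC : C ≤ ‖z - z'‖) : propQ D F C y := by
  have hlim : ∀ v : Y, Tendsto (fun l : ℕ => y + (1 / ((l : ℝ) + 1)) • (v - y)) atTop (nhds y) := by
    intro v
    have := (tendsto_one_div_add_atTop_nhds_zero_nat (𝕜 := ℝ)).smul_const (v - y)
    simpa using this.const_add y
  have hpos : ∀ l : ℕ, 0 < 1 / ((l : ℝ) + 1) := fun l => by positivity
  have hle : ∀ l : ℕ, 1 / ((l : ℝ) + 1) ≤ 1 := fun l => by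
    rw [div_le_one (by positivity)]
    have : (0 : ℝ) ≤ l := l.cast_nonneg
    linarith
  refine ⟨_, _, hlim z, hlim z', fun l => ⟨z, z', ?_, ?_, hC⟩⟩
  · rw [bestApprox_eq_setOf_isNearest, h.setOf_segment_eq_singleton (hpos l) (hle l)]
  · rw [bestApprox_eq_setOf_isNearest, h'.setOf_segment_eq_singleton (hpos l) (hle l)]

end NearestPoint

section WorstCase

variable {Y : Type} [NormedAddCommGroup Y] [InnerProductSpace ℝ Y] [FiniteDimensional ℝ Y]

theorem exists_isNearest {K : Set Y} (hK : IsClosed K) (hne : K.Nonempty) (y : Y) :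
    ∃ z, IsNearest K y z := by
  have : ProperSpace Y := FiniteDimensional.proper ℝ Y
  obtain ⟨z, hz, h⟩ := hK.exists_infDist_eq_dist hne y
  refine ⟨z, isNearest_of_norm_eq_infDist hz ?_⟩
  rw [h, dist_comm, dist_eq_norm]

theorem isCompact_setOf_isNearest {K : Set Y} (hK : IsClosed K) (y : Y) :
    IsCompact {z | IsNearest K y z} := by
  have : ProperSpace Y := FiniteDimensional.proper ℝ Y
  have h : {z | IsNearest K y z} = K ∩ sphere y (infDist y K) := by
    ext z
    rw [Set.mem_inter_iff, mem_sphere, dist_eq_norm]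
    exact ⟨fun h => ⟨h.1, h.norm_eq_infDist⟩, fun h => isNearest_of_norm_eq_infDist h.1 h.2⟩
  rw [h]
  exact (isCompact_sphere _ _).inter_left hK

/-- At a worst-case label vector `y`, no direction `v` orthogonal to `y` can be strictly obtuse to
all nearest points of `y`. -/
theorem exists_isNearest_inner_nonneg {K : Set Y} (hK : IsClosed K) (hne : K.Nonempty)
    {y v : Y} (hy : ‖y‖ = 1) (hlt : infDist y K < 1)
    (hmax : ∀ x, infDist x K ^ 2 ≤ infDist y K ^ 2 * ‖x‖ ^ 2) (hv : ⟪y, v⟫_ℝ = 0) :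
    ∃ z, IsNearest K y z ∧ 0 ≤ ⟪z, v⟫_ℝ := by
  have : ProperSpace Y := FiniteDimensional.proper ℝ Y
  set t : ℕ → ℝ := fun l => 1 / ((l : ℝ) + 1) with ht
  have htpos : ∀ l, 0 < t l := fun l => by positivity
  have hxlim : Tendsto (fun l => y + t l • v) atTop (nhds y) := by
    have := (tendsto_one_div_add_atTop_nhds_zero_nat (𝕜 := ℝ)).smul_const v
    simpa [ht] using this.const_add y
  choose z hz using fun l => exists_isNearest hK hne (y + t l • v)
  have hinner : ∀ l, 0 ≤ ⟪z l, v⟫_ℝ := by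
    intro l
    have h1 := hmax (y + t l • v)
    rw [← (hz l).norm_eq_infDist, ← sub_sub, norm_sub_sq_real, norm_add_sq_real, norm_smul,
      Real.norm_of_nonneg (htpos l).le, inner_smul_right, inner_smul_right, inner_sub_left,
      hv, hy] at h1
    have h2 : infDist y K ^ 2 ≤ ‖z l - y‖ ^ 2 := by
      refine pow_le_pow_left₀ infDist_nonneg ?_ 2
      rw [← dist_eq_norm, dist_comm]
      exact infDist_le_dist_of_mem (hz l).1
    have h3 : infDist y K ^ 2 ≤ 1 := pow_le_one₀ infDist_nonneg hlt.le
    have h4 := mul_le_mul_of_nonneg_right h3 (sq_nonneg (t l * ‖v‖))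
    refine nonneg_of_mul_nonneg_right (a := t l) ?_ (htpos l)
    nlinarith
  have hdist : Tendsto (fun l => ‖z l - (y + t l • v)‖) atTop (nhds (infDist y K)) := by
    simp only [(hz _).norm_eq_infDist]
    exact ((continuous_infDist_pt K).tendsto y).comp hxlim
  have hbdd : ∃ R, ∀ l, z l ∈ closedBall (0 : Y) R := by
    obtain ⟨R₁, hR₁⟩ := hdist.bddAbove_range
    obtain ⟨R₂, hR₂⟩ := hxlim.norm.bddAbove_range
    refine ⟨R₁ + R₂, fun l => ?_⟩
    have h1 := hR₁ ⟨l, rfl⟩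
    have h2 := hR₂ ⟨l, rfl⟩
    have h3 := norm_add_le (z l - (y + t l • v)) (y + t l • v)
    rw [sub_add_cancel] at h3
    rw [mem_closedBall_zero_iff]
    simp only at h1 h2
    linarith
  obtain ⟨R, hR⟩ := hbdd
  obtain ⟨a, -, φ, hφ, ha⟩ := (isCompact_closedBall (0 : Y) R).tendsto_subseq hR
  refine ⟨a, isNearest_of_norm_eq_infDist ?_ ?_, ?_⟩
  · exact hK.mem_of_tendsto ha (Eventually.of_forall fun l => (hz _).1)
  · exact tendsto_nhds_unique (ha.sub (hxlim.comp hφ.tendsto_atTop)).norm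
      (hdist.comp hφ.tendsto_atTop)
  · exact ge_of_tendsto' (ha.inner tendsto_const_nhds) fun l => hinner _

/-- In finite dimension the convex hull of a compact set is compact. -/
theorem isCompact_convexHull_of_isCompact {P : Set Y} (hP : IsCompact P) :
    IsCompact (convexHull ℝ P) := by
  let comb (k : ℕ) (q : (Fin k → ℝ) × (Fin k → Y)) : Y := ∑ i, q.1 i • q.2 i
  have heq : convexHull ℝ P = ⋃ k ∈ Finset.range (Module.finrank ℝ Y + 2),
      comb k '' (stdSimplex ℝ (Fin k) ×ˢ Set.univ.pi fun _ => P) := by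
    apply Set.Subset.antisymm
    · intro x hx
      obtain ⟨ι, _, z, w, hz, hind, hw, hsum, hcomb⟩ := eq_pos_convex_span_of_mem_convexHull hx
      have hcard : Fintype.card ι < Module.finrank ℝ Y + 2 :=
        Nat.lt_succ_of_le (hind.card_le_finrank_succ.trans
          (Nat.succ_le_succ (Submodule.finrank_le _)))
      let e := (Fintype.equivFin ι).symm
      refine Set.mem_biUnion (Finset.mem_coe.2 (Finset.mem_range.2 hcard))
        ⟨(w ∘ e, z ∘ e), ⟨⟨fun i => (hw _).le, ?_⟩, fun i _ => hz ⟨_, rfl⟩⟩, ?_⟩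
      · rw [← hsum]
        exact e.sum_comp w
      · rw [← hcomb]
        exact e.sum_comp fun i => w i • z i
    · refine Set.iUnion₂_subset fun k _ => ?_
      rintro _ ⟨⟨w, z⟩, ⟨hw, hz⟩, rfl⟩
      exact (convex_convexHull ℝ P).sum_mem (fun i _ => hw.1 i) hw.2
        fun i _ => subset_convexHull ℝ P (hz i trivial)
  rw [heq]
  refine (Finset.range _).isCompact_biUnion fun k _ => ?_
  exact ((isCompact_stdSimplex ℝ (Fin k)).prod (isCompact_univ_pi fun _ => hP)).image
    (by fun_prop)

theorem smul_mem_convexHull_setOf_isNearest {K : Set Y} (hK : IsClosed K) (hne : K.Nonempty)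
    (hcone : ∀ y ∈ K, ∀ s : ℝ, 0 ≤ s → s • y ∈ K) {y : Y} (hy : ‖y‖ = 1)
    (hlt : infDist y K < 1) (hmax : ∀ x, infDist x K ^ 2 ≤ infDist y K ^ 2 * ‖x‖ ^ 2) :
    (1 - infDist y K ^ 2) • y ∈ convexHull ℝ {z | IsNearest K y z} := by
  by_contra hmem
  obtain ⟨f, u, hfu, huf⟩ := geometric_hahn_banach_closed_point (convex_convexHull ℝ _)
    (isCompact_convexHull_of_isCompact (isCompact_setOf_isNearest hK y)).isClosed hmem
  set q := (InnerProductSpace.toDual ℝ Y).symm f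
  have hf : ∀ x, f x = ⟪x, q⟫_ℝ := fun x => by
    rw [real_inner_comm, InnerProductSpace.toDual_symm_apply]
  have hyy : ⟪y, y⟫_ℝ = 1 := by rw [real_inner_self_eq_norm_sq, hy, one_pow]
  obtain ⟨z, hz, hzv⟩ := exists_isNearest_inner_nonneg hK hne hy hlt hmax
    (v := q - ⟪y, q⟫_ℝ • y) (by rw [inner_sub_right, inner_smul_right, hyy]; ring)
  have h1 := (hfu z (subset_convexHull ℝ _ hz)).trans huf
  rw [inner_sub_right, inner_smul_right, hz.inner_eq_norm_sq hcone,
    hz.norm_sq_of_norm_eq_one hcone hy] at hzv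
  rw [hf, hf, inner_smul_left] at h1
  simp only [conj_trivial] at h1
  linarith

/-- Among affinely independent points of norm `√c` on the hyperplane `⟪·, y⟫ = c` whose convex
hull contains `c • y`, two are at least as far apart as the vertices of a regular simplex. -/
theorem exists_separated_pair_of_convex_combination {ι : Type*} [Fintype ι] {c : ℝ} {y : Y}
    (hy : ‖y‖ = 1) {z : ι → Y} {w : ι → ℝ} (hind : AffineIndependent ℝ z)
    (hw : ∀ i, 0 < w i) (hsum : ∑ i, w i = 1) (hcomb : ∑ i, w i • z i = c • y)
    (hnorm : ∀ i, ‖z i‖ ^ 2 = c) (hinner : ∀ i, ⟪z i, y⟫_ℝ = c) :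
    ∃ i j, (Module.finrank ℝ Y : ℝ) * (2 * (c - c ^ 2)) ≤
      ((Module.finrank ℝ Y : ℝ) - 1) * ‖z i - z j‖ ^ 2 := by
  have hne : Nonempty ι := by
    by_contra h
    rw [not_nonempty_iff] at h
    simp at hsum
  have hspan : vectorSpan ℝ (Set.range z) ≤ LinearMap.ker (innerₛₗ ℝ y) := by
    rw [vectorSpan_def, Submodule.span_le]
    rintro _ ⟨_, ⟨i, rfl⟩, _, ⟨j, rfl⟩, rfl⟩
    simp [inner_sub_right, real_inner_comm (z _) y, hinner]
  have hcard : Fintype.card ι ≤ Module.finrank ℝ Y := by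
    refine hind.card_le_finrank_succ.trans (Submodule.finrank_lt fun htop => ?_)
    have hmem : y ∈ LinearMap.ker (innerₛₗ ℝ y) := hspan (htop ▸ Submodule.mem_top)
    have hy0 : y = 0 := by simpa using hmem
    simp [hy0] at hy
  have hcard' : (Fintype.card ι : ℝ) ≤ Module.finrank ℝ Y := by exact_mod_cast hcard
  obtain ⟨i, hi⟩ := Finite.exists_max w
  obtain ⟨j, hj⟩ := Finite.exists_min fun j => ⟪z i, z j⟫_ℝ
  refine ⟨i, j, ?_⟩
  have h1 : 1 ≤ (Module.finrank ℝ Y : ℝ) * w i := by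
    have : ∑ k, w k ≤ Fintype.card ι * w i := by
      simpa using Finset.sum_le_sum fun k (_ : k ∈ Finset.univ) => hi k
    rw [hsum] at this
    exact this.trans (mul_le_mul_of_nonneg_right hcard' (hw i).le)
  have hii : ⟪z i, z i⟫_ℝ = c := by rw [real_inner_self_eq_norm_sq, hnorm]
  have h2 : w i * (c - ⟪z i, z j⟫_ℝ) ≤ c ^ 2 - ⟪z i, z j⟫_ℝ := by
    have hs : ∑ k, w k * (⟪z i, z k⟫_ℝ - ⟪z i, z j⟫_ℝ) = c ^ 2 - ⟪z i, z j⟫_ℝ := by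
      have h3 : ∑ k, w k * ⟪z i, z k⟫_ℝ = c ^ 2 := by
        simp only [← inner_smul_right, ← inner_sum]
        rw [hcomb, inner_smul_right, hinner]
        ring
      simp only [mul_sub, Finset.sum_sub_distrib, ← Finset.sum_mul, hsum, h3, one_mul]
    rw [← hs]
    have := Finset.single_le_sum (f := fun k => w k * (⟪z i, z k⟫_ℝ - ⟪z i, z j⟫_ℝ))
      (fun k _ => mul_nonneg (hw k).le (sub_nonneg.2 (hj k))) (Finset.mem_univ i)
    simpa only [hii] using this
  have h4 : 0 ≤ c - ⟪z i, z j⟫_ℝ := sub_nonneg.2 ((hj i).trans_eq hii)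
  rw [norm_sub_sq_real, hnorm, hnorm]
  have h5 := mul_le_mul_of_nonneg_right h1 h4
  have h6 := mul_le_mul_of_nonneg_left h2 (Nat.cast_nonneg (α := ℝ) (Module.finrank ℝ Y))
  nlinarith

theorem exists_separated_isNearest {K : Set Y} (hK : IsClosed K) (hne : K.Nonempty)
    (hcone : ∀ y ∈ K, ∀ s : ℝ, 0 ≤ s → s • y ∈ K) {y : Y} (hy : ‖y‖ = 1)
    (hlt : infDist y K < 1) (hmax : ∀ x, infDist x K ^ 2 ≤ infDist y K ^ 2 * ‖x‖ ^ 2) :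
    ∃ z z', IsNearest K y z ∧ IsNearest K y z' ∧
      (Module.finrank ℝ Y : ℝ) * (2 * (infDist y K ^ 2 - (infDist y K ^ 2) ^ 2)) ≤
        ((Module.finrank ℝ Y : ℝ) - 1) * ‖z - z'‖ ^ 2 := by
  obtain ⟨ι, _, z, w, hz, hind, hw, hsum, hcomb⟩ := eq_pos_convex_span_of_mem_convexHull
    (smul_mem_convexHull_setOf_isNearest hK hne hcone hy hlt hmax)
  have hnear : ∀ i, IsNearest K y (z i) := fun i => hz ⟨i, rfl⟩
  have hnorm : ∀ i, ‖z i‖ ^ 2 = 1 - infDist y K ^ 2 := fun i =>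
    (hnear i).norm_sq_of_norm_eq_one hcone hy
  obtain ⟨i, j, hij⟩ := exists_separated_pair_of_convex_combination hy hind hw hsum hcomb hnorm
    fun i => ((hnear i).inner_eq_norm_sq hcone).trans (hnorm i)
  refine ⟨z i, z j, hnear i, hnear j, le_trans (le_of_eq ?_) hij⟩
  ring

/-- Some unit vector is worst for the approximation by `K`, and by homogeneity its error bounds
the relative error of every vector. -/
theorem exists_unit_infDist_max [Nontrivial Y] {K : Set Y} (hK : IsClosed K) (hzero : 0 ∈ K)
    (hcone : ∀ y ∈ K, ∀ s : ℝ, 0 ≤ s → s • y ∈ K) :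
    ∃ y : Y, ‖y‖ = 1 ∧ ∀ x, infDist x K ^ 2 ≤ infDist y K ^ 2 * ‖x‖ ^ 2 := by
  have : ProperSpace Y := FiniteDimensional.proper ℝ Y
  obtain ⟨y, hy, hmax⟩ := (isCompact_sphere (0 : Y) 1).exists_isMaxOn
    (NormedSpace.sphere_nonempty.2 zero_le_one) (continuous_infDist_pt K).continuousOn
  refine ⟨y, mem_sphere_zero_iff_norm.1 hy, fun x => ?_⟩
  rcases eq_or_ne x 0 with rfl | hx
  · simp [infDist_zero_of_mem hzero]
  have hx' : 0 < ‖x‖ := norm_pos_iff.2 hx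
  obtain ⟨z, hz⟩ := exists_isNearest hK ⟨0, hzero⟩ (‖x‖⁻¹ • x)
  have h1 := (hz.smul hcone hx').norm_eq_infDist
  rw [smul_inv_smul₀ hx'.ne'] at h1
  have h2 : ‖x‖ • z - x = ‖x‖ • (z - ‖x‖⁻¹ • x) := by rw [smul_sub, smul_inv_smul₀ hx'.ne']
  have h3 : infDist (‖x‖⁻¹ • x) K ≤ infDist y K :=
    hmax (mem_sphere_zero_iff_norm.2 (by rw [norm_smul, norm_inv, norm_norm,
      inv_mul_cancel₀ hx'.ne']))
  rw [← h1, h2, norm_smul, norm_norm, hz.norm_eq_infDist, mul_pow, mul_comm]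
  exact mul_le_mul_of_nonneg_right (pow_le_pow_left₀ infDist_nonneg h3 2) (sq_nonneg _)

end WorstCase

theorem smul_mem_closure_of_cone {Y : Type} [NormedAddCommGroup Y] [InnerProductSpace ℝ Y]
    {S : Set Y} (hS : ∀ y ∈ S, ∀ s : ℝ, 0 < s → s • y ∈ S) :
    ∀ y ∈ closure S, ∀ s : ℝ, 0 ≤ s → s • y ∈ closure S := by
  have hpos : ∀ y ∈ closure S, ∀ s : ℝ, 0 < s → s • y ∈ closure S := fun y hy s hs =>
    map_mem_closure (continuous_const_smul s) hy fun x hx => hS x hx s hs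
  intro y hy s hs
  have hlim : Tendsto (fun l : ℕ => (s + 1 / ((l : ℝ) + 1)) • y) atTop (nhds (s • y)) := by
    have := (tendsto_one_div_add_atTop_nhds_zero_nat (𝕜 := ℝ)).const_add s
    simpa using this.smul_const y
  exact isClosed_closure.mem_of_tendsto hlim
    (Eventually.of_forall fun l => hpos y hy _ (by positivity))

theorem not_countable_of_ray_subset {Y : Type} [NormedAddCommGroup Y] [InnerProductSpace ℝ Y]
    {A : Set Y} {y : Y} (hy : y ≠ 0) (h : ∀ s : ℝ, 1 ≤ s → s • y ∈ A) : ¬ A.Countable := by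
  intro hA
  have hsub : Set.Ici (1 : ℝ) ⊆ (fun s : ℝ => s • y) ⁻¹' A := fun s hs => h s hs
  have hcount := (hA.preimage (smul_left_injective ℝ hy)).mono hsub
  have := hcount.le_aleph0
  rw [Cardinal.mk_Ici_real] at this
  exact absurd this (not_le.2 Cardinal.aleph0_lt_continuum)

theorem bestApprox_instability {Y : Type} [NormedAddCommGroup Y]
    [InnerProductSpace ℝ Y] [FiniteDimensional ℝ Y] [Nontrivial Y] {m : ℕ}
    (D : Set (Fin m → ℝ)) (hD : D.Nonempty) (F : (Fin m → ℝ) → Y)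
    (hcone : ∀ y ∈ F '' D, ∀ s : ℝ, 0 < s → s • y ∈ F '' D)
    (hexpr : ∀ y : Y, y ≠ 0 → lossInf D F y < ‖y‖ ^ 2)
    (hcl : closure (F '' D) ≠ Set.univ) :
    ∀ C : ℝ, 0 < C →
      ¬ Set.Countable {yd : Y | propQ D F C yd} ∧
      ∃ yd : Y,
        ‖yd‖ = C * Real.sqrt (((Module.finrank ℝ Y : ℝ) - 1) /
          (2 * (Module.finrank ℝ Y : ℝ) * (Theta D F - Theta D F ^ 2))) ∧
        ∀ s : ℝ, 1 ≤ s → propQ D F C (s • yd) := by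
  intro C hC
  have hKcone := smul_mem_closure_of_cone hcone
  have hloss := lossInf_eq_infDist_sq hD F
  have hne : (closure (F '' D)).Nonempty := (hD.image F).closure
  have hKcl : IsClosed (closure (F '' D)) := isClosed_closure
  have hzero : (0 : Y) ∈ closure (F '' D) := by
    obtain ⟨x, hx⟩ := hne
    simpa using hKcone x hx 0 le_rfl
  obtain ⟨y, hy, hmax⟩ := exists_unit_infDist_max hKcl hzero hKcone
  have hy0 : y ≠ 0 := by
    rintro rfl
    simp at hy
  have hlt : infDist y (closure (F '' D)) < 1 := by
    have := hexpr y hy0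
    rw [hloss, hy, one_pow, sq_lt_one_iff₀ infDist_nonneg] at this
    exact this
  have hTheta : Theta D F = infDist y (closure (F '' D)) ^ 2 := by
    refine IsGreatest.csSup_eq ⟨⟨y, hy, hloss y⟩, ?_⟩
    rintro _ ⟨x, hx, rfl⟩
    have := hmax x
    rw [show ‖x‖ = 1 from hx, one_pow, mul_one] at this
    simpa only [hloss] using this
  have hpos : 0 < infDist y (closure (F '' D)) ^ 2 := by
    obtain ⟨x, hx⟩ := (Set.ne_univ_iff_exists_notMem _).1 hcl
    have h1 : 0 < infDist x (closure (F '' D)) := (hKcl.notMem_iff_infDist_pos hne).1 hx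
    by_contra! h
    nlinarith [hmax x, sq_nonneg ‖x‖, pow_pos h1 2]
  obtain ⟨z, z', hz, hz', hsep⟩ := exists_separated_isNearest hKcl hne hKcone hy hlt hmax
  rw [hTheta]
  have hlt' : infDist y (closure (F '' D)) ^ 2 < 1 := (sq_lt_one_iff₀ infDist_nonneg).2 hlt
  have hn : (0 : ℝ) < Module.finrank ℝ Y := by exact_mod_cast Module.finrank_pos
  generalize infDist y (closure (F '' D)) ^ 2 = θ at *
  generalize (Module.finrank ℝ Y : ℝ) = n at *
  have hq : 0 < θ - θ ^ 2 := by nlinarith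
  have hn1 : 0 < n - 1 := by
    by_contra! h
    nlinarith [mul_pos hn hq, sq_nonneg ‖z - z'‖]
  set r := C * Real.sqrt ((n - 1) / (2 * n * (θ - θ ^ 2))) with hr
  have hrpos : 0 < r := by positivity
  have hrsep : C ≤ r * ‖z - z'‖ := by
    refine le_of_sq_le_sq ?_ (by positivity)
    rw [hr, mul_pow, mul_pow, Real.sq_sqrt (by positivity), mul_assoc]
    refine le_mul_of_one_le_right (by positivity) ?_
    rw [div_mul_eq_mul_div, one_le_div (by positivity)]
    linarith
  have hray : ∀ s : ℝ, 1 ≤ s → propQ D F C (s • r • y) := by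
    intro s hs
    have hspos : 0 < s * r := by positivity
    rw [smul_smul]
    refine (hz.smul hKcone hspos).propQ (hz'.smul hKcone hspos) ?_
    rw [← smul_sub, norm_smul, Real.norm_of_nonneg hspos.le, mul_assoc]
    exact hrsep.trans (le_mul_of_one_le_left (by positivity) hs)
  refine ⟨not_countable_of_ray_subset (smul_ne_zero hrpos.ne' hy0) hray, r • y, ?_, hray⟩
  rw [norm_smul, hy, mul_one, Real.norm_of_nonneg hrpos.le]
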